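/- arXiv:2501.04189 — 6 statements merged into one kernel-verified Lean document; each statement's English description precedes it below -/
import Mathlib

section
/- Even–Gillis formula: For any n ≥ 1 and positive integers k_1,…,k_n, the number of multiset derangements satisfies |D(k_1,…,k_n)| = (-1)^{k_1+⋯+k_n} · (∏_{i=1}^n k_i!) · ∫_0^∞ (∏_{i=1}^n L_{k_i}^{(0)}(x)) e^{-x} dx. -/
open MeasureTheory Finset

/-- The generalized Laguerre polynomial
`L_k^{(α)}(x) = Σ_{i=0}^k (-1)^i (∏_{j=i+1}^k (α+j)) / (i! (k-i)!) x^i`. -/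
noncomputable def laguerre (α : ℝ) (k : ℕ) (x : ℝ) : ℝ :=
  ∑ i ∈ Finset.range (k + 1),
    (-1 : ℝ) ^ i * (∏ j ∈ Finset.Icc (i + 1) k, (α + (j : ℝ))) /
      ((Nat.factorial i : ℝ) * (Nat.factorial (k - i) : ℝ)) * x ^ i

theorem card_perm_insert_mul {α ι : Type*} [Fintype α] [DecidableEq α] [DecidableEq ι]
    (f : α → ι) (S : Finset α) {a : α} (ha : a ∉ S) :
    (Fintype.card α - #S) * #{π : Equiv.Perm α | ∀ x ∈ insert a S, f (π x) = f x} =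
      #{π : Equiv.Perm α | ∀ x ∈ S, f (π x) = f x} *
        (#{x | f x = f a} - #{x ∈ S | f x = f a}) := by
  have hfib (b : α) (hb : b ∈ Sᶜ) :
      #{π ∈ {π : Equiv.Perm α | ∀ x ∈ S, f (π x) = f x} | f (π b) = f a} =
        #{π : Equiv.Perm α | ∀ x ∈ insert a S, f (π x) = f x} := by
    have hfix (x : α) (hx : x ∈ S) : Equiv.swap a b x = x := by
      refine Equiv.swap_apply_of_ne_of_ne ?_ ?_
      · rintro rfl; exact ha hx
      · rintro rfl; exact (mem_compl.1 hb) hx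
    refine card_bij' (fun π _ => π * Equiv.swap a b) (fun π _ => π * Equiv.swap a b) ?_ ?_ ?_ ?_
    · intro π hπ
      simp only [mem_filter, mem_univ, true_and, mem_insert, forall_eq_or_imp,
        Equiv.Perm.mul_apply, Equiv.swap_apply_left] at hπ ⊢
      exact ⟨hπ.2, fun x hx => by rw [hfix x hx]; exact hπ.1 x hx⟩
    · intro π hπ
      simp only [mem_filter, mem_univ, true_and, mem_insert, forall_eq_or_imp,
        Equiv.Perm.mul_apply, Equiv.swap_apply_right] at hπ ⊢
      exact ⟨fun x hx => by rw [hfix x hx]; exact hπ.2 x hx, hπ.1⟩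
    · intro π _
      simp [mul_assoc]
    · intro π _
      simp [mul_assoc]
  have hcol (π : Equiv.Perm α) (hπ : π ∈ ({π | ∀ x ∈ S, f (π x) = f x} : Finset _)) :
      #{b ∈ Sᶜ | f (π b) = f a} = #{x | f x = f a} - #{x ∈ S | f x = f a} := by
    simp only [mem_filter, mem_univ, true_and] at hπ
    have h1 : #{x | f (π x) = f a} = #{x | f x = f a} :=
      card_bij (fun x _ => π x) (by simp) (by simp) (fun b hb => ⟨π.symm b, by simpa using hb⟩)
    have h2 : #{x ∈ S | f (π x) = f a} = #{x ∈ S | f x = f a} := by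
      congr 1
      exact filter_congr fun x hx => by rw [hπ x hx]
    have h3 : #{x ∈ S | f (π x) = f a} + #{b ∈ Sᶜ | f (π b) = f a} = #{x | f (π x) = f a} := by
      rw [← card_union_of_disjoint (disjoint_filter_filter disjoint_compl_right),
        ← filter_union, union_compl]
    omega
  calc _ = ∑ b ∈ Sᶜ, #{π ∈ {π : Equiv.Perm α | ∀ x ∈ S, f (π x) = f x} | f (π b) = f a} := by
        rw [sum_congr rfl hfib, sum_const, card_compl, smul_eq_mul]
    _ = ∑ π ∈ ({π : Equiv.Perm α | ∀ x ∈ S, f (π x) = f x} : Finset _),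
          #{b ∈ Sᶜ | f (π b) = f a} := by
        simp_rw [card_filter (fun π : Equiv.Perm α => f (π _) = f a), card_filter _ Sᶜ]
        exact sum_comm
    _ = _ := by rw [sum_congr rfl hcol, sum_const, smul_eq_mul]

theorem card_perm_forall_mem_apply_eq {α ι : Type*} [Fintype α] [DecidableEq α] [Fintype ι]
    [DecidableEq ι] (f : α → ι) (S : Finset α) :
    #{π : Equiv.Perm α | ∀ x ∈ S, f (π x) = f x} =
      (Fintype.card α - #S).factorial *
        ∏ i, (#{x | f x = i}).descFactorial #{x ∈ S | f x = i} := by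
  induction S using Finset.induction_on with
  | empty => simp [Fintype.card_perm]
  | insert a S ha ih =>
    have hlt : #S < Fintype.card α := by
      rw [← card_univ]
      exact card_lt_card (ssubset_univ_iff.2 fun h => ha (h ▸ mem_univ a))
    have hpos : 0 < Fintype.card α - #S := by omega
    have hprod : ∏ i, (#{x | f x = i}).descFactorial #{x ∈ insert a S | f x = i} =
        (#{x | f x = f a} - #{x ∈ S | f x = f a}) *
          ∏ i, (#{x | f x = i}).descFactorial #{x ∈ S | f x = i} := by
      rw [← mul_prod_erase _ _ (mem_univ (f a)),
        ← mul_prod_erase (univ : Finset ι) _ (mem_univ (f a)), ← mul_assoc]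
      congr 1
      · rw [filter_insert, if_pos rfl, card_insert_of_notMem (by simp [ha]),
          Nat.descFactorial_succ]
      · refine prod_congr rfl fun i hi => ?_
        rw [filter_insert, if_neg (ne_of_mem_erase hi).symm]
    have hfac : (Fintype.card α - #S).factorial =
        (Fintype.card α - #S) * (Fintype.card α - (#S + 1)).factorial := by
      rw [← Nat.mul_factorial_pred hpos.ne', Nat.sub_sub]
    apply Nat.eq_of_mul_eq_mul_left hpos
    rw [card_perm_insert_mul f S ha, ih, hprod, card_insert_of_notMem ha, hfac]
    ring

theorem card_perm_forall_apply_ne {α ι : Type*} [Fintype α] [DecidableEq α]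
    [DecidableEq ι] (f : α → ι)
    [DecidablePred fun π : Equiv.Perm α => ∀ x, f (π x) ≠ f x] :
    (#{π : Equiv.Perm α | ∀ x, f (π x) ≠ f x} : ℝ) =
      ∑ S : Finset α, (-1) ^ #S * (#{π : Equiv.Perm α | ∀ x ∈ S, f (π x) = f x} : ℝ) := by
  have h (π : Equiv.Perm α) : (if ∀ x, f (π x) ≠ f x then (1 : ℝ) else 0) =
      ∑ S : Finset α, (-1) ^ #S * if ∀ x ∈ S, f (π x) = f x then 1 else 0 := by
    calc _ = ∏ x, ((-if f (π x) = f x then (1 : ℝ) else 0) + 1) := by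
          split_ifs with hπ
          · exact (prod_eq_one fun x _ => by simp [hπ x]).symm
          · push Not at hπ
            obtain ⟨x, hx⟩ := hπ
            exact (prod_eq_zero (mem_univ x) (by simp [hx])).symm
      _ = _ := by
          rw [prod_add_one, powerset_univ]
          refine sum_congr rfl fun S _ => ?_
          rw [prod_neg, prod_ite_zero]
          simp
  simp_rw [card_filter, Nat.cast_sum, Nat.cast_ite, Nat.cast_one, Nat.cast_zero, h, mul_sum]
  exact sum_comm

theorem sum_prod_card_filter_eq {α ι R : Type*} [Fintype α] [DecidableEq α] [Fintype ι]
    [DecidableEq ι] [CommSemiring R] (f : α → ι) (g : ι → ℕ → R) :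
    ∑ S : Finset α, ∏ i, g i #{x ∈ S | f x = i} =
      ∏ i, ∑ s ∈ range (#{x | f x = i} + 1), (#{x | f x = i}).choose s • g i s := by
  simp_rw [← sum_powerset_apply_card]
  rw [prod_univ_sum]
  refine sum_bij' (fun S _ i => {x ∈ S | f x = i}) (fun p _ => ({x | x ∈ p (f x)} : Finset α)) ?_ ?_ ?_ ?_ ?_
  · intro S _
    simp only [Fintype.mem_piFinset, mem_powerset]
    exact fun i => filter_subset_filter _ (subset_univ S)
  · simp
  · intro S _
    ext x
    simp
  · intro p hp
    simp only [Fintype.mem_piFinset, mem_powerset] at hp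
    ext i x
    simp only [mem_filter, mem_univ, true_and]
    constructor
    · rintro ⟨h, rfl⟩
      exact h
    · intro h
      obtain rfl : f x = i := by simpa using hp i h
      exact ⟨h, rfl⟩
  · simp

theorem sum_choose_descFactorial_eq_laguerre (k : ℕ) (x : ℝ) :
    ∑ s ∈ range (k + 1), k.choose s • ((-1) ^ s * (k.descFactorial s : ℝ) * x ^ (k - s)) =
      (-1) ^ k * (k.factorial : ℝ) * laguerre 0 k x := by
  rw [← sum_range_reflect, laguerre, mul_sum]
  refine sum_congr rfl fun i hmem => ?_
  have hi : i ≤ k := by simpa [Nat.lt_succ_iff] using hmem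
  have hprod : (i.factorial : ℝ) * ∏ j ∈ Icc (i + 1) k, ((0 : ℝ) + j) = k.factorial := by
    simp_rw [zero_add]
    clear hmem
    induction k, hi using Nat.le_induction with
    | base => simp
    | succ k hk ih =>
      rw [prod_Icc_succ_top (by omega), ← mul_assoc, ih, Nat.factorial_succ]
      push_cast
      ring
  have hdesc : (i.factorial : ℝ) * k.descFactorial (k - i) = k.factorial := by
    have := Nat.factorial_mul_descFactorial (Nat.sub_le k i)
    rw [Nat.sub_sub_self hi] at this
    exact_mod_cast this
  have hdp : (k.descFactorial (k - i) : ℝ) = ∏ j ∈ Icc (i + 1) k, ((0 : ℝ) + j) :=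
    mul_left_cancel₀ (by positivity) (hdesc.trans hprod.symm)
  have hsign : (-1 : ℝ) ^ k * (-1) ^ i = (-1) ^ (k - i) := by
    obtain ⟨m, rfl⟩ := Nat.exists_eq_add_of_le hi
    rw [Nat.add_sub_cancel_left, pow_add, mul_right_comm, ← mul_pow]
    simp
  have hpred : k + 1 - 1 - i = k - i := rfl
  rw [hpred, Nat.choose_symm hi, Nat.sub_sub_self hi, ← hsign, nsmul_eq_mul, hdp,
    Nat.cast_choose ℝ hi]
  ring

theorem integrableOn_pow_mul_exp_neg (m : ℕ) :
    IntegrableOn (fun x : ℝ => x ^ m * Real.exp (-x)) (Set.Ioi 0) := by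
  have h := Real.GammaIntegral_convergent (s := m + 1) (by positivity)
  refine h.congr_fun (fun x _ => ?_) measurableSet_Ioi
  simp [mul_comm]

theorem integral_pow_mul_exp_neg (m : ℕ) :
    ∫ x in Set.Ioi (0 : ℝ), x ^ m * Real.exp (-x) = m.factorial := by
  rw [← Real.Gamma_nat_eq_factorial, Real.Gamma_eq_integral (by positivity)]
  refine setIntegral_congr_fun measurableSet_Ioi fun x _ => ?_
  simp [mul_comm]

/-- **Even–Gillis formula.**  For `n ≥ 1` and positive integers `k 1, …, k n`,
with blocks given by the fibers of `f`, the number of multiset derangements equals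
`(-1)^{k_1+⋯+k_n} (∏ k_i!) ∫_0^∞ (∏ L_{k_i}^{(0)}(x)) e^{-x} dx`. -/
theorem even_gillis (n : ℕ) (hn : 1 ≤ n) (k : Fin n → ℕ) (hk : ∀ i, 1 ≤ k i)
    (f : Fin (∑ i, k i) → Fin n)
    (hf : ∀ i : Fin n, (Finset.univ.filter fun x => f x = i).card = k i) :
    (((Finset.univ.filter
        fun π : Equiv.Perm (Fin (∑ i, k i)) => ∀ x, f (π x) ≠ f x).card : ℝ)) =
      (-1 : ℝ) ^ (∑ i, k i) * (∏ i, (Nat.factorial (k i) : ℝ)) *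
        ∫ x in Set.Ioi (0 : ℝ), (∏ i, laguerre 0 (k i) x) * Real.exp (-x) := by
  have hsum (S : Finset (Fin (∑ i, k i))) : ∑ i, #{x ∈ S | f x = i} = #S :=
    (card_eq_sum_card_fiberwise fun _ _ => mem_univ _).symm
  have hle (S : Finset (Fin (∑ i, k i))) (i : Fin n) : #{x ∈ S | f x = i} ≤ k i :=
    hf i ▸ card_le_card (filter_subset_filter _ (subset_univ S))
  have hpoly (x : ℝ) : (-1 : ℝ) ^ (∑ i, k i) * (∏ i, ((k i).factorial : ℝ)) *
      ∏ i, laguerre 0 (k i) x = ∑ S : Finset (Fin (∑ i, k i)),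
        (-1) ^ #S * (∏ i, ((k i).descFactorial #{x ∈ S | f x = i} : ℝ)) *
          x ^ (∑ i, k i - #S) := by
    rw [← prod_pow_eq_pow_sum, ← prod_mul_distrib, ← prod_mul_distrib]
    simp_rw [← sum_choose_descFactorial_eq_laguerre]
    have h := sum_prod_card_filter_eq f
      fun i s => (-1) ^ s * ((k i).descFactorial s : ℝ) * x ^ (k i - s)
    simp_rw [hf] at h
    rw [← h]
    refine sum_congr rfl fun S _ => ?_
    rw [prod_mul_distrib, prod_mul_distrib, prod_pow_eq_pow_sum, prod_pow_eq_pow_sum, hsum,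
      sum_tsub_distrib _ fun i _ => hle S i, hsum]
  rw [card_perm_forall_apply_ne, ← integral_const_mul]
  simp_rw [← mul_assoc, hpoly, sum_mul, mul_assoc _ (_ ^ _) (Real.exp _)]
  rw [integral_finsetSum _ fun S _ => (integrableOn_pow_mul_exp_neg _).const_mul _]
  refine sum_congr rfl fun S _ => ?_
  rw [integral_const_mul, integral_pow_mul_exp_neg, card_perm_forall_mem_apply_eq]
  simp_rw [hf, Fintype.card_fin]
  push_cast
  ring
end

section
/- Foata–Zeilberger weighted formula: For any n ≥ 1, positive integers k_1,…,k_n, and real α > 0, the cycle-weight enumerator of multiset derangements satisfies Σ_{π ∈ D(k_1,…,k_n)} α^{cyc(π)} = ((-1)^{k_1+⋯+k_n} / Γ(α)) · (∏_{i=1}^n k_i!) · ∫_0^∞ (∏_{i=1}^n L_{k_i}^{(α-1)}(x)) x^{α-1} e^{-x} dx. -/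
open MeasureTheory Finset

/-- The number of cycles of a permutation of a finite type: the number of orbits,
where fixed points count as cycles of length 1.  It equals the number of
nontrivial cycles (the length of the cycle type) plus the number of fixed points. -/
def cyc {β : Type*} [Fintype β] [DecidableEq β] (π : Equiv.Perm β) : ℕ :=
  Multiset.card π.cycleType + (Finset.univ.filter fun x => π x = x).card

namespace Equiv.Perm

variable {β γ : Type*}

theorem cyc_eq_card_quotient [Fintype β] [DecidableEq β] (π : Perm β) :
    cyc π = Nat.card (Quotient (SameCycle.setoid π)) := by
  classical
  let Φ : β → Perm β ⊕ β := fun x => if π x = x then Sum.inr x else Sum.inl (π.cycleOf x)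
  have hker : SameCycle.setoid π = Setoid.ker Φ := by
    ext x y
    change π.SameCycle x y ↔ Φ x = Φ y
    by_cases hx : π x = x
    · have hxy : π.SameCycle x y ↔ x = y :=
        ⟨fun h => h.eq_of_left hx, fun h => h ▸ SameCycle.refl π x⟩
      by_cases hy : π y = y
      · simp [Φ, hx, hy, hxy]
      · simp only [Φ, hx, hy, hxy, if_true, if_false, reduceCtorEq, iff_false]
        rintro rfl
        exact hy hx
    · by_cases hy : π y = y
      · simp only [Φ, hx, hy, if_true, if_false, reduceCtorEq, iff_false]
        intro h
        rw [h.eq_of_right hy] at hx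
        exact hx hy
      · simp only [Φ, hx, hy, if_false, Sum.inl.injEq]
        exact sameCycle_iff_cycleOf_eq_of_mem_support (mem_support.2 hx) (mem_support.2 hy)
  have himage : Set.range Φ =
      ↑(π.cycleFactorsFinset.disjSum (Finset.univ.filter fun x => π x = x)) := by
    ext z
    rcases z with c | x
    · simp only [Set.mem_range, Finset.mem_coe, Finset.inl_mem_disjSum]
      constructor
      · rintro ⟨x, hx⟩
        by_cases h : π x = x
        · simp [Φ, h] at hx
        · simp only [Φ, h, if_false, Sum.inl.injEq] at hx
          rw [← hx, cycleOf_mem_cycleFactorsFinset_iff]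
          exact mem_support.2 h
      · intro hc
        obtain ⟨x, hx⟩ := (mem_cycleFactorsFinset_iff.1 hc).1.nonempty_support
        have hxπ := mem_support.1 (mem_cycleFactorsFinset_support_le hc hx)
        exact ⟨x, by simp [Φ, hxπ, cycle_is_cycleOf hx hc]⟩
    · simp only [Set.mem_range, Finset.mem_coe, Finset.inr_mem_disjSum, Finset.mem_filter,
        Finset.mem_univ, true_and]
      constructor
      · rintro ⟨y, hy⟩
        by_cases h : π y = y
        · simp only [Φ, h, if_true, Sum.inr.injEq] at hy
          rwa [← hy]
        · simp [Φ, h] at hy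
      · intro h
        exact ⟨x, by simp [Φ, h]⟩
  rw [hker, Nat.card_congr (Setoid.quotientKerEquivRange Φ), himage]
  simp [cyc, cycleType_def, Finset.card_disjSum]

theorem SameCycle.of_forall_rel {π : Perm β} {r : β → β → Prop} (hr : Equivalence r)
    (h : ∀ x, r x (π x)) {x y : β} (hxy : π.SameCycle x y) : r x y := by
  obtain ⟨i, rfl⟩ := hxy
  induction i with
  | zero => exact hr.refl x
  | succ i ih =>
    rw [add_comm, zpow_one_add, mul_apply]
    exact hr.trans ih (h _)
  | pred i ih =>
    refine hr.trans ih (hr.symm ?_)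
    have := h ((π ^ (-(i : ℤ) - 1)) x)
    rwa [← mul_apply, ← zpow_one_add, add_sub_cancel] at this

theorem cyc_permCongr [Fintype β] [DecidableEq β] [Fintype γ] [DecidableEq γ] (e : β ≃ γ)
    (π : Perm β) : cyc (e.permCongr π) = cyc π := by
  rw [cyc_eq_card_quotient, cyc_eq_card_quotient]
  refine (Nat.card_congr (Quotient.congr e fun x y => ?_)).symm
  change π.SameCycle x y ↔ (e.permCongr π).SameCycle (e x) (e y)
  constructor
  · refine SameCycle.of_forall_rel
      (r := fun x y => (e.permCongr π).SameCycle (e x) (e y))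
      ⟨fun x => .refl _ _, .symm, .trans⟩ fun x => ⟨1, by simp⟩
  · intro h
    have := SameCycle.of_forall_rel (r := fun x y => π.SameCycle (e.symm x) (e.symm y))
      ⟨fun x => .refl _ _, .symm, .trans⟩ (fun x => ⟨1, by simp⟩) h
    simpa using this

theorem cyc_decomposeOption_symm_none [Fintype γ] [DecidableEq γ] (σ : Perm γ) :
    cyc (decomposeOption.symm (none, σ)) = cyc σ + 1 := by
  simp only [cyc_eq_card_quotient]
  set τ := decomposeOption.symm (none, σ) with hτ
  have hnone : τ none = none := by simp [hτ]
  have hsome (x : γ) : τ (some x) = some (σ x) := by simp [hτ]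
  have hsame (x y : γ) : τ.SameCycle (some x) (some y) ↔ σ.SameCycle x y := by
    constructor
    · intro h
      have := SameCycle.of_forall_rel (r := Option.Rel σ.SameCycle)
        ⟨fun x => ?_, fun h => ?_, fun h h' => ?_⟩ (fun x => ?_) h
      · simpa using this
      · cases x <;> constructor; exact .refl _ _
      · cases h <;> constructor; exact .symm ‹_›
      · cases h <;> cases h' <;> constructor; exact .trans ‹_› ‹_›
      · cases x with
        | none => rw [hnone]; constructor
        | some x => rw [hsome]; constructor; exact ⟨1, by simp⟩
    · refine SameCycle.of_forall_rel (r := fun x y => τ.SameCycle (some x) (some y))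
        ⟨fun x => .refl _ _, .symm, .trans⟩ fun x => ⟨1, by simp [hsome]⟩
  rw [← Finite.card_option]
  refine Nat.card_congr ⟨fun q => q.lift (fun u => u.map (Quotient.mk _)) ?_,
    fun q => q.elim (Quotient.mk _ none) (fun q => q.map some fun x y h => (hsame x y).2 h),
    ?_, ?_⟩
  · rintro (_ | x) (_ | y) h
    · rfl
    · exact absurd (SameCycle.eq_of_left h hnone) (by simp)
    · exact absurd (SameCycle.eq_of_right h hnone) (by simp)
    · exact congrArg some (Quotient.sound ((hsame x y).1 h))
  · rintro ⟨_ | x⟩ <;> rfl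
  · rintro (_ | x)
    · rfl
    · induction x using Quotient.inductionOn
      rfl

theorem cyc_decomposeOption_symm_some [Fintype γ] [DecidableEq γ] (a : γ) (σ : Perm γ) :
    cyc (decomposeOption.symm (some a, σ)) = cyc σ := by
  simp only [cyc_eq_card_quotient]
  set τ := decomposeOption.symm (some a, σ) with hτ
  have hnone : τ none = some a := by simp [hτ]
  have hsome (x : γ) : τ (some x) = if σ x = a then none else some (σ x) := by
    split_ifs with h
    · simp [hτ, h]
    · simp [hτ, swap_apply_of_ne_of_ne, h]
  have hproj {u v : Option γ} (h : τ.SameCycle u v) : σ.SameCycle (u.getD a) (v.getD a) := by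
    refine SameCycle.of_forall_rel (r := fun u v : Option γ => σ.SameCycle (u.getD a) (v.getD a))
      ⟨fun x => .refl _ _, .symm, .trans⟩ (fun x => ?_) h
    cases x with
    | none => simpa [hnone] using SameCycle.refl σ a
    | some x =>
      rw [hsome]
      split_ifs with hx
      · exact ⟨1, by simp [hx]⟩
      · exact ⟨1, by simp⟩
  have hlift {x y : γ} (h : σ.SameCycle x y) : τ.SameCycle (some x) (some y) := by
    refine SameCycle.of_forall_rel (r := fun x y => τ.SameCycle (some x) (some y))
      ⟨fun x => .refl _ _, .symm, .trans⟩ (fun x => ?_) h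
    by_cases hx : σ x = a
    · exact ⟨2, by simp [sq, hsome, hx, hnone]⟩
    · exact ⟨1, by simp [hsome, hx]⟩
  refine Nat.card_congr ⟨fun q => q.map (fun u => u.getD a) fun u v h => hproj h,
    fun q => q.map some fun x y h => hlift h, ?_, ?_⟩
  · rintro ⟨_ | x⟩
    · exact Quotient.sound (SameCycle.symm ⟨1, by simp [hnone]⟩)
    · rfl
  · rintro ⟨x⟩
    rfl

end Equiv.Perm

section RestrictedSum

open Equiv.Perm

variable {β γ ι : Type*} [Fintype β] [DecidableEq β] [Fintype γ] [DecidableEq γ]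
  [DecidableEq ι]

/-- The cycle-weight enumerator of the permutations that move every element of `S` to another
fiber of `f`. -/
def restrictedCycSum (α : ℝ) (f : β → ι) (S : Finset β) : ℝ :=
  ∑ π : Equiv.Perm β, if ∀ x ∈ S, f (π x) ≠ f x then α ^ cyc π else 0

theorem restrictedCycSum_map_equiv (α : ℝ) (e : γ ≃ β) (f : β → ι) (S : Finset γ) :
    restrictedCycSum α f (S.map e.toEmbedding) = restrictedCycSum α (f ∘ e) S := by
  unfold restrictedCycSum
  rw [← e.permCongr.sum_comp]
  refine sum_congr rfl fun π _ => if_congr ?_ (by rw [cyc_permCongr]) rfl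
  simp only [forall_mem_map, Equiv.coe_toEmbedding, Equiv.permCongr_apply,
    Equiv.symm_apply_apply, Function.comp_apply]

theorem sum_pow_cyc_option (α : ℝ) (P : Option γ → Prop) [DecidablePred P] (hP : P none)
    (Q : Equiv.Perm (Option γ) → Prop) [DecidablePred Q]
    (R : Equiv.Perm γ → Prop) [DecidablePred R]
    (hQ : ∀ i σ, Q (decomposeOption.symm (i, σ)) ↔ P i ∧ R σ) :
    (∑ π : Equiv.Perm (Option γ), if Q π then α ^ cyc π else 0) =
      (α + (univ.filter fun y : γ => P (some y)).card) *
        ∑ σ : Equiv.Perm γ, if R σ then α ^ cyc σ else 0 := by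
  rw [← decomposeOption.symm.sum_comp, Fintype.sum_prod_type]
  simp only [hQ, Fintype.sum_option, cyc_decomposeOption_symm_none,
    cyc_decomposeOption_symm_some, hP, true_and, add_mul, pow_succ]
  congr 1
  · rw [mul_sum]
    refine sum_congr rfl fun σ _ => ?_
    split_ifs <;> ring
  · rw [card_filter, Nat.cast_sum, sum_mul]
    refine sum_congr rfl fun y _ => ?_
    by_cases hy : P (some y) <;> simp [hy]

theorem restrictedCycSum_empty (α : ℝ) (f : β → ι) :
    restrictedCycSum α f ∅ = ∏ j ∈ range (Fintype.card β), (α + j) := by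
  suffices h : ∑ π : Equiv.Perm β, α ^ cyc π = ∏ j ∈ range (Fintype.card β), (α + j) by
    simpa [restrictedCycSum] using h
  clear f
  generalize hm : Fintype.card β = m
  induction m generalizing β with
  | zero =>
    have := Fintype.card_eq_zero_iff.1 hm
    simp [cyc]
  | succ m ih =>
    have hpos : Nonempty β := Fintype.card_pos_iff.1 (by lia)
    obtain ⟨x⟩ := hpos
    let e := Equiv.optionSubtypeNe x
    have hcard : Fintype.card {y // y ≠ x} = m := by
      simp [hm]
    rw [← e.permCongr.sum_comp]
    have := sum_pow_cyc_option (γ := {y // y ≠ x}) α (fun _ => True) trivial (fun _ => True)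
      (fun _ => True) (by simp)
    simp only [if_true, ih hcard, filter_true, card_univ, hcard] at this
    simp only [cyc_permCongr, this, prod_range_succ, mul_comm]

theorem restrictedCycSum_insertNone (α : ℝ) (f : Option γ → ι) (S : Finset γ) :
    restrictedCycSum α f (insertNone S) =
      restrictedCycSum α f (S.map Function.Embedding.some) -
        (α + (univ.filter fun y : γ => f (some y) = f none).card) *
          restrictedCycSum α (f ∘ some) S := by
  unfold restrictedCycSum
  rw [← sum_pow_cyc_option α (fun i => f i = f none) rfl
    (fun π => f (π none) = f none ∧ ∀ x ∈ S, f (π (some x)) ≠ f (some x)),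
    ← sum_sub_distrib]
  · refine sum_congr rfl fun π _ => ?_
    have hins : (∀ x ∈ insertNone S, f (π x) ≠ f x) ↔
        f (π none) ≠ f none ∧ ∀ x ∈ S, f (π (some x)) ≠ f (some x) := forall_mem_insertNone
    have hmap : (∀ x ∈ S.map Function.Embedding.some, f (π x) ≠ f x) ↔
        ∀ x ∈ S, f (π (some x)) ≠ f (some x) := forall_mem_map
    simp only [hins, hmap]
    by_cases h : f (π none) = f none <;> simp [h]
  · intro i σ
    have hswap (hi : f i = f none) (u : Option γ) : f (Equiv.swap none i u) = f u := by
      rcases eq_or_ne u none with rfl | h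
      · simpa using hi
      · rcases eq_or_ne u i with rfl | h'
        · simpa using hi.symm
        · rw [Equiv.swap_apply_of_ne_of_ne h h']
    simp only [decomposeOption_symm_apply, Equiv.Perm.mul_apply, Equiv.optionCongr_apply,
      Option.map_none, Option.map_some, Equiv.swap_apply_left, Function.comp_apply]
    refine and_congr_right fun hi => ?_
    simp only [hswap hi]

end RestrictedSum

section GammaFunctional

open Polynomial

theorem Real.prod_range_add_mul_Gamma {α : ℝ} (hα : 0 < α) (m : ℕ) :
    (∏ j ∈ range m, (α + j)) * Real.Gamma α = Real.Gamma (α + m) := by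
  induction m with
  | zero => simp
  | succ m ih =>
    rw [prod_range_succ, mul_right_comm, ih, Nat.cast_succ, ← add_assoc,
      Real.Gamma_add_one (by positivity), mul_comm]

theorem integrableOn_pow_mul_rpow_mul_exp_neg {α : ℝ} (hα : 0 < α) (m : ℕ) :
    IntegrableOn (fun x : ℝ => x ^ m * x ^ (α - 1) * Real.exp (-x)) (Set.Ioi 0) := by
  refine (Real.GammaIntegral_convergent (s := α + m) (by positivity)).congr_fun
    (fun x hx => ?_) measurableSet_Ioi
  have hx : 0 < x := hx
  change Real.exp (-x) * x ^ (α + m - 1) = x ^ m * x ^ (α - 1) * Real.exp (-x)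
  rw [add_sub_right_comm, Real.rpow_add_natCast hx.ne']
  ring

theorem integral_pow_mul_rpow_mul_exp_neg {α : ℝ} (hα : 0 < α) (m : ℕ) :
    ∫ x in Set.Ioi (0 : ℝ), x ^ m * x ^ (α - 1) * Real.exp (-x) = Real.Gamma (α + m) := by
  rw [Real.Gamma_eq_integral (by positivity)]
  refine setIntegral_congr_fun measurableSet_Ioi fun x hx => ?_
  have hx : 0 < x := hx
  change x ^ m * x ^ (α - 1) * Real.exp (-x) = Real.exp (-x) * x ^ (α + m - 1)
  rw [add_sub_right_comm, Real.rpow_add_natCast hx.ne']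
  ring

theorem integrableOn_polynomial_mul_rpow_mul_exp_neg {α : ℝ} (hα : 0 < α) (p : ℝ[X]) :
    IntegrableOn (fun x : ℝ => p.eval x * x ^ (α - 1) * Real.exp (-x)) (Set.Ioi 0) := by
  induction p using Polynomial.induction_on' with
  | add p q hp hq =>
    simp only [eval_add, add_mul]
    exact hp.add hq
  | monomial m a =>
    have := (integrableOn_pow_mul_rpow_mul_exp_neg hα m).const_mul a
    simp only [mul_assoc] at this
    simpa only [eval_monomial, mul_assoc, IntegrableOn] using this

/-- The integral of a polynomial against the Gamma density of shape `α`. -/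
noncomputable def gammaFunctional (α : ℝ) (p : ℝ[X]) : ℝ :=
  (∫ x in Set.Ioi (0 : ℝ), p.eval x * x ^ (α - 1) * Real.exp (-x)) / Real.Gamma α

theorem gammaFunctional_sub_C_mul {α : ℝ} (hα : 0 < α) (p q : ℝ[X]) (c : ℝ) :
    gammaFunctional α (p - C c * q) = gammaFunctional α p - c * gammaFunctional α q := by
  unfold gammaFunctional
  rw [mul_div_assoc', ← integral_const_mul, ← sub_div, ← integral_sub
    (integrableOn_polynomial_mul_rpow_mul_exp_neg hα p)
    ((integrableOn_polynomial_mul_rpow_mul_exp_neg hα q).const_mul c)]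
  simp only [eval_sub, eval_mul, eval_C, sub_mul, mul_assoc]

theorem gammaFunctional_X_pow {α : ℝ} (hα : 0 < α) (m : ℕ) :
    gammaFunctional α (X ^ m) = ∏ j ∈ range m, (α + j) := by
  simp only [gammaFunctional, eval_pow, eval_X]
  rw [integral_pow_mul_rpow_mul_exp_neg hα, ← Real.prod_range_add_mul_Gamma hα,
    mul_div_cancel_right₀ _ (Real.Gamma_pos_of_pos hα).ne']

end GammaFunctional

section PartialLaguerre

open Polynomial

/-- Polynomials interpolating between `X ^ k` (at `s = 0`) and the rescaled Laguerre polynomial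
`(-1) ^ k * k! * L_k^{(α-1)}` (at `s = k`). -/
noncomputable def partialLaguerre (α : ℝ) : ℕ → ℕ → ℝ[X]
  | k, 0 => X ^ k
  | 0, _ + 1 => 0
  | k + 1, s + 1 => partialLaguerre α (k + 1) s - C (α + k) * partialLaguerre α k s

theorem partialLaguerre_zero (α : ℝ) (k : ℕ) : partialLaguerre α k 0 = X ^ k := by
  simp [partialLaguerre]

theorem partialLaguerre_succ_succ (α : ℝ) (k s : ℕ) :
    partialLaguerre α (k + 1) (s + 1) =
      partialLaguerre α (k + 1) s - C (α + k) * partialLaguerre α k s := by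
  rw [partialLaguerre]

theorem eval_partialLaguerre (α x : ℝ) {k s : ℕ} (hs : s ≤ k) :
    (partialLaguerre α k s).eval x = ∑ j ∈ range (s + 1),
      (-1) ^ j * (s.choose j : ℝ) * (∏ l ∈ range j, (α + k - 1 - l)) * x ^ (k - j) := by
  induction s generalizing k with
  | zero => simp [partialLaguerre_zero]
  | succ s ih =>
    obtain ⟨k, rfl⟩ : ∃ m, k = m + 1 := ⟨k - 1, by lia⟩
    rw [partialLaguerre_succ_succ, eval_sub, eval_mul, eval_C, ih (by lia), ih (by lia),
      sum_range_succ' _ (s + 1), sum_range_succ' _ s, mul_sum]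
    have hprod (j : ℕ) : ∏ l ∈ range (j + 1), (α + (k + 1 : ℕ) - 1 - l) =
        (α + k) * ∏ l ∈ range j, (α + k - 1 - l) := by
      rw [prod_range_succ', mul_comm]
      congr 1
      · push_cast; ring
      · refine prod_congr rfl fun l _ => ?_
        push_cast; ring
    have hext : ∑ j ∈ range s, (-1 : ℝ) ^ (j + 1) * (s.choose (j + 1) : ℝ) *
          (∏ l ∈ range (j + 1), (α + (k + 1 : ℕ) - 1 - l)) * x ^ (k + 1 - (j + 1)) =
        ∑ j ∈ range (s + 1), (-1 : ℝ) ^ (j + 1) * (s.choose (j + 1) : ℝ) *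
          (∏ l ∈ range (j + 1), (α + (k + 1 : ℕ) - 1 - l)) * x ^ (k + 1 - (j + 1)) := by
      rw [sum_range_succ _ s]
      simp
    rw [hext, add_sub_right_comm, ← sum_sub_distrib]
    congr 1
    · refine sum_congr rfl fun j _ => ?_
      rw [hprod, Nat.choose_succ_succ, Nat.add_sub_add_right]
      push_cast
      ring
    · simp

theorem eval_partialLaguerre_self (α x : ℝ) (k : ℕ) :
    (partialLaguerre α k k).eval x = (-1) ^ k * (k.factorial : ℝ) * laguerre (α - 1) k x := by
  rw [eval_partialLaguerre α x le_rfl, laguerre, mul_sum, ← sum_range_reflect]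
  refine sum_congr rfl fun i hi => ?_
  have hik : i ≤ k := by simpa [Nat.lt_succ_iff] using hi
  obtain ⟨m, rfl⟩ := Nat.exists_eq_add_of_le hik
  have hprod : ∏ j ∈ Icc (i + 1) (i + m), (α - 1 + (j : ℝ)) =
      ∏ l ∈ range m, (α + (i + m : ℕ) - 1 - l) := by
    rw [← Ico_add_one_right_eq_Icc, prod_Ico_eq_prod_range,
      show i + m + 1 - (i + 1) = m by lia, ← prod_range_reflect]
    refine prod_congr rfl fun l hl => ?_
    obtain ⟨r, rfl⟩ : ∃ r, m = l + r + 1 := Nat.exists_eq_add_of_lt (mem_range.1 hl)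
    rw [show l + r + 1 - 1 - l = r by lia]
    push_cast
    ring
  rw [show i + m + 1 - 1 - i = m by lia, show i + m - m = i by lia,
    show i + m - i = m by lia, hprod, Nat.choose_symm_add.symm,
    Nat.cast_add_choose]
  have hsign : (-1 : ℝ) ^ (i + m) * (-1) ^ i = (-1) ^ m := by
    rw [← pow_add, add_right_comm, pow_add, Even.neg_one_pow ⟨i, rfl⟩, one_mul]
  rw [← hsign]
  field_simp

end PartialLaguerre

section

variable {β ι : Type*} [Fintype β] [DecidableEq β] [Fintype ι] [DecidableEq ι]

theorem restrictedCycSum_eq_gammaFunctional {α : ℝ} (hα : 0 < α) (f : β → ι) (S : Finset β) :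
    restrictedCycSum α f S = gammaFunctional α (∏ i, partialLaguerre α
      (univ.filter fun x => f x = i).card (S.filter fun x => f x = i).card) := by
  generalize hm : S.card = m
  induction m generalizing β with
  | zero =>
    obtain rfl := card_eq_zero.1 hm
    simp only [filter_empty, card_empty, partialLaguerre_zero, prod_pow_eq_pow_sum,
      sum_card_fiberwise_eq_card_filter, restrictedCycSum_empty, gammaFunctional_X_pow hα]
    simp
  | succ m ih =>
    obtain ⟨x, hx⟩ : S.Nonempty := card_pos.1 (by lia)
    let e := Equiv.optionSubtypeNe x
    obtain ⟨T, rfl⟩ : ∃ T : Finset {y // y ≠ x}, S = (insertNone T).map e.toEmbedding := by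
      refine ⟨S.subtype (· ≠ x), ?_⟩
      ext y
      rcases eq_or_ne y x with rfl | hy
      · simp [e, hx]
      · simp [e, hy]
    have hT : T.card = m := by simpa using hm
    rw [restrictedCycSum_map_equiv, restrictedCycSum_insertNone, ih _ _ (by simpa using hT),
      ih _ _ hT, ← gammaFunctional_sub_C_mul hα]
    congr 1
    set g := f ∘ e with hg
    have huniv (i : ι) : (univ.filter fun y => f y = i).card =
        (univ.filter fun y => g (some y) = i).card + if g none = i then 1 else 0 := by
      rw [← map_univ_equiv e, filter_map, card_map]
      simp only [card_filter, Fintype.sum_option]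
      simp [hg, add_comm]
    have hinsert (i : ι) : (((insertNone T).map e.toEmbedding).filter fun y => f y = i).card =
        (T.filter fun y => g (some y) = i).card + if g none = i then 1 else 0 := by
      rw [filter_map, card_map]
      simp only [card_filter, sum_insertNone]
      simp [hg, add_comm]
    have hoption (i : ι) : (univ.filter fun y => g y = i).card =
        (univ.filter fun y => g (some y) = i).card + if g none = i then 1 else 0 := by
      simp only [card_filter, Fintype.sum_option, add_comm]
    have hmap (i : ι) : ((T.map Function.Embedding.some).filter fun y => g y = i).card =
        (T.filter fun y => g (some y) = i).card := by
      rw [filter_map, card_map]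
      rfl
    simp only [huniv, hinsert, hoption, hmap, Function.comp_apply]
    simp only [← mul_prod_erase univ _ (mem_univ (g none)), if_true]
    have herase (F : ι → ℕ → ℕ → Polynomial ℝ) (a b : ι → ℕ) :
        ∏ i ∈ univ.erase (g none), F i (a i + if g none = i then 1 else 0)
          (b i + if g none = i then 1 else 0) = ∏ i ∈ univ.erase (g none), F i (a i) (b i) :=
      prod_congr rfl fun i hi => by simp [(ne_of_mem_erase hi).symm]
    have herase' (F : ι → ℕ → ℕ → Polynomial ℝ) (a b : ι → ℕ) :
        ∏ i ∈ univ.erase (g none), F i (a i + if g none = i then 1 else 0) (b i) =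
          ∏ i ∈ univ.erase (g none), F i (a i) (b i) :=
      prod_congr rfl fun i hi => by simp [(ne_of_mem_erase hi).symm]
    rw [herase (fun _ => partialLaguerre α), herase' (fun _ => partialLaguerre α),
      partialLaguerre_succ_succ]
    ring

end

/-- **Foata–Zeilberger weighted formula.**  For `n ≥ 1`, positive integers
`k 1, …, k n` (blocks given by the fibers of `f`), and real `α > 0`, the cycle-weight
enumerator of multiset derangements equals
`((-1)^{k_1+⋯+k_n} / Γ(α)) (∏ k_i!) ∫_0^∞ (∏ L_{k_i}^{(α-1)}(x)) x^{α-1} e^{-x} dx`. -/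
theorem foata_zeilberger (n : ℕ) (hn : 1 ≤ n) (k : Fin n → ℕ) (hk : ∀ i, 1 ≤ k i)
    (α : ℝ) (hα : 0 < α)
    (f : Fin (∑ i, k i) → Fin n)
    (hf : ∀ i : Fin n, (Finset.univ.filter fun x => f x = i).card = k i) :
    (∑ π ∈ (Finset.univ.filter
        fun π : Equiv.Perm (Fin (∑ i, k i)) => ∀ x, f (π x) ≠ f x), α ^ cyc π) =
      (-1 : ℝ) ^ (∑ i, k i) / Real.Gamma α * (∏ i, (Nat.factorial (k i) : ℝ)) *
        ∫ x in Set.Ioi (0 : ℝ),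
          (∏ i, laguerre (α - 1) (k i) x) * x ^ (α - 1) * Real.exp (-x) := by
  have hmain := restrictedCycSum_eq_gammaFunctional hα f univ
  simp only [restrictedCycSum, mem_univ, true_imp_iff, hf, ← sum_filter] at hmain
  rw [hmain, gammaFunctional]
  simp only [Polynomial.eval_prod, eval_partialLaguerre_self, prod_mul_distrib,
    prod_pow_eq_pow_sum, mul_assoc, integral_const_mul]
  ring
end

section
/- Recurrence for weighted derangements (k = 1): For every n ≥ 0, F_1(n+2) = (n+1) · F_1(n+1) + α · (n+1) · F_1(n), where F_1(n)(α) = Σ_{π a derangement of an n-element set} α^{cyc(π)} (a polynomial in α), equivalently -α(n+1)F_1(n) - (n+1)F_1(n+1) + F_1(n+2) = 0. -/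
open Finset

/-- `F_1(n)(α) = Σ_{π a derangement of an n-element set} α^{cyc(π)}`. -/
noncomputable def F1 (n : ℕ) (α : ℝ) : ℝ :=
  ∑ π ∈ (Finset.univ.filter fun π : Equiv.Perm (Fin n) => ∀ x, π x ≠ x), α ^ cyc π

namespace Equiv.Perm

variable {β γ : Type*} [Fintype β] [DecidableEq β] [Fintype γ] [DecidableEq γ]

theorem card_cycleType_swap_mul_of_fixed_of_fixed {σ : Perm β} {x y : β} (hxy : x ≠ y)
    (hx : σ x = x) (hy : σ y = y) :
    Multiset.card (swap x y * σ).cycleType = Multiset.card σ.cycleType + 1 := by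
  have hd : Disjoint (swap x y) σ := by
    intro z
    by_cases hzx : z = x
    · exact Or.inr (hzx ▸ hx)
    by_cases hzy : z = y
    · exact Or.inr (hzy ▸ hy)
    exact Or.inl (swap_apply_of_ne_of_ne hzx hzy)
  rw [hd.cycleType_mul, Multiset.card_add, card_cycleType_eq_one.2 (isCycle_swap hxy), add_comm]

theorem card_cycleType_swap_mul_self {F : Perm β} {x : β} (hx : F x ≠ x) (hxx : F (F x) ≠ x) :
    Multiset.card (swap x (F x) * F).cycleType = Multiset.card F.cycleType := by
  set c := F.cycleOf x with hc
  have hcx : c x = F x := cycleOf_apply_self F x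
  have hcyc : c.IsCycle := isCycle_cycleOf F hx
  have hccx : c (c x) ≠ x := by
    rw [hcx, hc, (sameCycle_apply_right.2 (SameCycle.refl F x)).cycleOf_apply]
    exact hxx
  have hcyc' : (swap x (c x) * c).IsCycle := hcyc.swap_mul (hcx ▸ hx) hccx
  have hd : Disjoint (F * c⁻¹) c :=
    disjoint_mul_inv_of_mem_cycleFactorsFinset (cycleOf_mem_cycleFactorsFinset_iff.2
      (mem_support.2 hx))
  have hd' : Disjoint (F * c⁻¹) (swap x (c x) * c) := by
    intro z
    refine (hd z).imp_right fun hz => ?_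
    have h₁ : z ≠ x := by
      rintro rfl
      exact hx (hcx ▸ hz)
    have h₂ : z ≠ c x := by
      rintro rfl
      exact hx (hcx ▸ c.injective hz)
    rw [mul_apply, hz, swap_apply_of_ne_of_ne h₁ h₂]
  have hF : F = c * (F * c⁻¹) := by
    rw [← hd.commute.eq]; simp
  have hs : swap x (F x) * F = swap x (c x) * c * (F * c⁻¹) := by
    rw [mul_assoc, ← hF, hcx]
  rw [hs, hd'.symm.cycleType_mul]
  conv_rhs => rw [hF, hd.symm.cycleType_mul]
  rw [Multiset.card_add, Multiset.card_add, card_cycleType_eq_one.2 hcyc,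
    card_cycleType_eq_one.2 hcyc']

theorem card_cycleType_swap_mul_of_fixed_of_not_fixed {σ : Perm β} {x y : β} (hxy : x ≠ y)
    (hx : σ x = x) (hy : σ y ≠ y) :
    Multiset.card (swap x y * σ).cycleType = Multiset.card σ.cycleType := by
  have hσy : σ y ≠ x := fun h => hxy (σ.injective (hx.trans h.symm))
  have h₁ : (swap x y * σ) x = y := by simp [hx]
  have h₂ : (swap x y * σ) y = σ y := by simp [swap_apply_of_ne_of_ne hσy hy]
  have := card_cycleType_swap_mul_self (F := swap x y * σ) (x := x) (by rw [h₁]; exact hxy.symm)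
    (by rw [h₁, h₂]; exact hσy)
  rw [← this, h₁, swap_mul_self_mul]

theorem cycleType_permCongr (e : β ≃ γ) (σ : Perm β) :
    (e.permCongr σ).cycleType = σ.cycleType := by
  have h := cycleType_extendDomain (p := fun _ : γ => True) (e.trans (Equiv.Set.univ γ).symm)
    (g := σ)
  rw [← h]
  congr 1

theorem cycleType_optionCongr (σ : Perm β) : cycleType (optionCongr σ) = σ.cycleType := by
  have h := cycleType_extendDomain (p := fun z : Option β => z.isSome)
    (optionIsSomeEquiv β).symm (g := σ)
  rw [← h]
  congr 1
  ext1 z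
  cases z with
  | none => rw [extendDomain_apply_not_subtype _ _ (by simp)]; rfl
  | some z => rw [extendDomain_apply_subtype _ _ (by simp)]; rfl

end Equiv.Perm

open Equiv Equiv.Perm

/-- The sum of `α ^ (number of cycles)` over the derangements of a finite type. -/
noncomputable def weightedDerangements (β : Type*) [Fintype β] [DecidableEq β] (α : ℝ) : ℝ :=
  ∑ π : Perm β with ∀ x, π x ≠ x, α ^ Multiset.card π.cycleType

theorem F1_eq_weightedDerangements (n : ℕ) (α : ℝ) :
    F1 n α = weightedDerangements (Fin n) α := by
  refine sum_congr (by ext; simp) fun π hπ => ?_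
  have h : (univ.filter fun x => π x = x) = ∅ := by
    simpa [filter_eq_empty_iff] using hπ
  rw [cyc, h, card_empty, add_zero]

section

variable {β γ : Type*} [Fintype β] [DecidableEq β] [Fintype γ] [DecidableEq γ]

theorem weightedDerangements_congr (e : β ≃ γ) (α : ℝ) :
    weightedDerangements β α = weightedDerangements γ α := by
  refine sum_equiv e.permCongr (fun π => ?_) fun π _ => by rw [cycleType_permCongr]
  simp only [mem_filter, mem_univ, true_and, permCongr_apply]
  rw [e.forall_congr_left]
  simp [eq_symm_apply]

theorem sum_perm_unique_fixedPoint (a : β) (α : ℝ) :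
    ∑ π : Perm β with ∀ x, π x = x ↔ x = a, α ^ Multiset.card π.cycleType =
      weightedDerangements {x // x ≠ a} α := by
  symm
  refine sum_nbij (fun π => ofSubtype π) (fun π hπ => ?_) (ofSubtype_injective.injOn)
    (fun f hf => ?_) fun π _ => by rw [cycleType_ofSubtype]
  · simp only [mem_filter, mem_univ, true_and] at hπ ⊢
    intro x
    by_cases hx : x = a
    · simp [hx, ofSubtype_apply_of_not_mem]
    · rw [ofSubtype_apply_of_mem π hx]
      exact iff_of_false (fun h => hπ ⟨x, hx⟩ (Subtype.ext h)) hx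
  · simp only [coe_filter, mem_univ, true_and, Set.mem_ofPred_eq] at hf
    have hfa : f a = a := (hf a).2 rfl
    have h : ∀ x, f x ≠ a ↔ x ≠ a := fun x => not_congr
      ⟨fun hx => f.injective (hx.trans hfa.symm), fun hx => hx ▸ hfa⟩
    refine ⟨f.subtypePerm h, ?_, ofSubtype_subtypePerm h fun x hx hxa => hx ((hf x).2 hxa)⟩
    simp only [coe_filter, mem_univ, true_and, Set.mem_ofPred_eq]
    rintro ⟨x, hx⟩ hfx
    exact hx ((hf x).1 (congrArg Subtype.val hfx))

theorem derangement_decomposeOption_symm_iff {β : Type*} [DecidableEq β] (a : β) (f : Perm β) :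
    (∀ x, Perm.decomposeOption.symm (some a, f) x ≠ x) ↔ ∀ x, f x = x → x = a := by
  have hF : ∀ x : Option β, Perm.decomposeOption.symm (some a, f) x = x ↔
      optionCongr f x = swap none (some a) x := fun x => by
    rw [Perm.decomposeOption_symm_apply, Perm.mul_apply, swap_apply_eq_iff]
  simp only [ne_eq, hF, Option.forall]
  refine ⟨fun h x hx => ?_, fun h => ⟨by simp, fun x hx => ?_⟩⟩
  · by_contra hxa
    exact h.2 x (by simp [swap_apply_of_ne_of_ne, hxa, hx])
  · by_cases hxa : x = a
    · simp [hxa] at hx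
    · rw [swap_apply_of_ne_of_ne (by simp) (by simpa using hxa)] at hx
      exact hxa (h x (by simpa using hx))

theorem sum_derangements_option_fiber (a : β) (α : ℝ) :
    ∑ f : Perm β, (if ∀ x, Perm.decomposeOption.symm (some a, f) x ≠ x then
      α ^ Multiset.card (Perm.decomposeOption.symm (some a, f)).cycleType else 0) =
      weightedDerangements β α + α * weightedDerangements {x // x ≠ a} α := by
  rw [← sum_perm_unique_fixedPoint, weightedDerangements, mul_sum, sum_filter, sum_filter,
    ← sum_add_distrib]
  refine sum_congr rfl fun f _ => ?_
  simp only [derangement_decomposeOption_symm_iff]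
  rw [Perm.decomposeOption_symm_apply]
  by_cases hfa : f a = a
  · have h₁ : ¬ ∀ x, f x ≠ x := fun h => h a hfa
    have h₂ : (∀ x, f x = x → x = a) ↔ ∀ x, f x = x ↔ x = a :=
      forall_congr' fun x => ⟨fun h => ⟨h, fun hx => hx ▸ hfa⟩, Iff.mp⟩
    rw [if_neg h₁, zero_add, card_cycleType_swap_mul_of_fixed_of_fixed (by simp) (by simp)
      (by simp [hfa]), cycleType_optionCongr, pow_succ']
    simp only [h₂]
  · have h₁ : ¬ ∀ x, f x = x ↔ x = a := fun h => hfa ((h a).2 rfl)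
    have h₂ : (∀ x, f x = x → x = a) ↔ ∀ x, f x ≠ x :=
      forall_congr' fun x => ⟨fun h hx => hfa (h hx ▸ hx), fun h hx => absurd hx h⟩
    rw [if_neg h₁, add_zero, card_cycleType_swap_mul_of_fixed_of_not_fixed (by simp) (by simp)
      (by simp [hfa]), cycleType_optionCongr]
    simp only [h₂]

theorem weightedDerangements_option (α : ℝ) :
    weightedDerangements (Option β) α =
      ∑ a : β, (weightedDerangements β α + α * weightedDerangements {x // x ≠ a} α) := by
  rw [weightedDerangements, sum_filter, ← Perm.decomposeOption.symm.sum_comp,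
    Fintype.sum_prod_type, Fintype.sum_option]
  simp only [sum_derangements_option_fiber]
  rw [add_eq_right]
  refine sum_eq_zero fun f _ => if_neg fun h => h none ?_
  simp

end

/-- **Recurrence for weighted derangements (k = 1).**  For every `n ≥ 0`,
`F_1(n+2) = (n+1)·F_1(n+1) + α·(n+1)·F_1(n)`. -/
theorem weighted_derangement_recurrence (n : ℕ) (α : ℝ) :
    F1 (n + 2) α = ((n : ℝ) + 1) * F1 (n + 1) α + α * ((n : ℝ) + 1) * F1 n α := by
  have h (a : Fin (n + 1)) :
      weightedDerangements {x // x ≠ a} α = weightedDerangements (Fin n) α :=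
    weightedDerangements_congr (finSuccAboveEquiv a).symm α
  simp only [F1_eq_weightedDerangements]
  rw [weightedDerangements_congr (finSuccEquiv (n + 1)), weightedDerangements_option]
  simp only [h, sum_const, card_univ, Fintype.card_fin, nsmul_eq_mul]
  push_cast
  ring
end

section
/- Recurrence for weighted multiset derangements with blocks of size 2: For every n ≥ 0, the polynomials F_2(n) = F_2(n)(α) satisfy 4α(2n+5)(n+2)(n+1)(α+1)² F_2(n) + 2(n+2)(α+1)(4αn² + 12αn - 4n² + 7α - 14n - 10) F_2(n+1) - 2(n+2)(4αn + 4n² + 8α + 16n + 17) F_2(n+2) + (2n+3) F_2(n+3) = 0. -/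
open Finset

/-- The weight enumerator `F_2(m)(α) = Σ_{π ∈ D(2,…,2)} α^{cyc(π)}` of multiset
derangements with `m` blocks of size `2`, the blocks being the fibers of `f`. -/
noncomputable def F2 {m : ℕ} (f : Fin (2 * m) → Fin m) (α : ℝ) : ℝ :=
  ∑ π ∈ (Finset.univ.filter fun π : Equiv.Perm (Fin (2 * m)) => ∀ x, f (π x) ≠ f x),
    α ^ cyc π

section CycleCount

open Equiv Equiv.Perm

variable {β γ : Type*} [Fintype β] [DecidableEq β] [Fintype γ] [DecidableEq γ]

lemma cyc_add_card_support (π : Perm β) :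
    cyc π + #π.support = Multiset.card π.cycleType + Fintype.card β := by
  have h := Finset.card_filter_add_card_filter_not (s := (univ : Finset β)) (fun x => π x = x)
  have h' : #π.support = #(univ.filter fun x => ¬ π x = x) := by
    congr 1
  rw [Finset.card_univ] at h
  unfold cyc
  omega

/-- Short-circuiting a cycle at `x` splits off `x` as a new fixed point. -/
lemma cyc_swap_mul (g : Perm β) {x : β} (hx : g x ≠ x) :
    cyc (swap x (g x) * g) = cyc g + 1 := by
  have hmem : g.cycleOf x ∈ g.cycleFactorsFinset :=
    cycleOf_mem_cycleFactorsFinset_iff.2 (mem_support.2 hx)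
  have hd := (disjoint_mul_inv_of_mem_cycleFactorsFinset hmem).symm
  have hc : IsCycle (g.cycleOf x) := isCycle_cycleOf g hx
  have hcx : g.cycleOf x x = g x := cycleOf_apply_self g x
  have hg : g = g.cycleOf x * (g * (g.cycleOf x)⁻¹) := by
    rw [hd.commute.eq]
    simp
  generalize g.cycleOf x = c at *
  generalize g * c⁻¹ = r at *
  rw [← hcx] at hx ⊢
  have hgT : g.cycleType = c.cycleType + r.cycleType := by rw [hg, hd.cycleType_mul]
  have hgS : #g.support = #c.support + #r.support := by rw [hg, hd.card_support_mul]
  have key := cyc_add_card_support g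
  have key' := cyc_add_card_support (swap x (c x) * g)
  rw [hgT, hc.cycleType, hgS] at key
  by_cases h2 : c (c x) = x
  · have h1 : swap x (c x) * c = 1 := by
      conv_lhs => rw [hc.eq_swap_of_apply_apply_eq_self hx h2]
      simp
    have hcs : #c.support = 2 := by
      rw [hc.eq_swap_of_apply_apply_eq_self hx h2, card_support_swap hx.symm]
    have h3 : swap x (c x) * g = r := by rw [hg, ← mul_assoc, h1, one_mul]
    rw [h3] at key' ⊢
    simp at key
    omega
  · have hs := support_swap_mul_eq c x h2
    have hcs : #(swap x (c x) * c).support + 1 = #c.support := by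
      rw [hs, sdiff_singleton_eq_erase, card_erase_add_one (mem_support.2 hx)]
    have hd' : Disjoint (swap x (c x) * c) r := by
      rw [disjoint_iff_disjoint_support] at hd ⊢
      rw [hs]
      exact hd.mono_left sdiff_subset
    have h3 : swap x (c x) * g = (swap x (c x) * c) * r := by rw [hg, mul_assoc]
    rw [h3] at key' ⊢
    rw [hd'.cycleType_mul, hd'.card_support_mul, (hc.swap_mul hx h2).cycleType] at key'
    simp at key key'
    omega

lemma cyc_permCongr (e : γ ≃ β) (π : Perm γ) : cyc (e.permCongr π) = cyc π := by
  have h : e.permCongr π =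
      π.extendDomain
        (e.trans (Equiv.subtypeUnivEquiv (p := fun _ : β => True) fun _ => trivial).symm) := by
    ext x
    rw [Equiv.Perm.extendDomain_apply_subtype (h := trivial)]
    rfl
  have h1 := cyc_add_card_support (e.permCongr π)
  have h2 := cyc_add_card_support π
  rw [← sum_cycleType] at h1 h2
  rw [h, cycleType_extendDomain, ← h, ← Fintype.card_congr e] at h1
  omega

lemma cyc_optionCongr (π : Perm γ) : cyc (optionCongr π) = cyc π + 1 := by
  have h : optionCongr π = π.extendDomain (Equiv.optionIsSomeEquiv γ).symm := by
    ext1 x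
    cases x with
    | none => rw [Equiv.Perm.extendDomain_apply_not_subtype _ _ (by simp)]; rfl
    | some x => rw [Equiv.Perm.extendDomain_apply_subtype (h := by simp)]; rfl
  have h1 := cyc_add_card_support (optionCongr π)
  have h2 := cyc_add_card_support π
  rw [← sum_cycleType] at h1 h2
  rw [h, cycleType_extendDomain, ← h, Fintype.card_option] at h1
  omega

lemma cyc_swap_none_mul_optionCongr (i : γ) (π : Perm γ) :
    cyc (swap none (some i) * optionCongr π) = cyc π := by
  have h := cyc_swap_mul (swap none (some i) * optionCongr π) (x := none) (by simp)
  have h0 : (swap none (some i) * optionCongr π) none = some i := by simp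
  rw [h0, ← mul_assoc, swap_mul_self, one_mul, cyc_optionCongr] at h
  omega

end CycleCount

section CyclePermanent

open Equiv

variable {β γ : Type*} [Fintype β] [DecidableEq β] [Fintype γ] [DecidableEq γ]

/-- The `α`-permanent of a matrix, in which a permutation is weighted by `α ^ cyc π`. -/
noncomputable def cycPermanent (α : ℝ) (M : β → β → ℝ) : ℝ :=
  ∑ π : Perm β, α ^ cyc π * ∏ x, M x (π x)

lemma cycPermanent_reindex (α : ℝ) (e : γ ≃ β) (M : β → β → ℝ) :
    cycPermanent α (fun x y => M (e x) (e y)) = cycPermanent α M := by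
  unfold cycPermanent
  rw [← e.permCongr.sum_comp]
  refine Finset.sum_congr rfl fun π _ => ?_
  rw [cyc_permCongr, ← e.prod_comp]
  simp

/-- The matrix `M` with column `i` replaced by ones. -/
def setColumnOne (M : γ → γ → ℝ) (i : γ) (x y : γ) : ℝ :=
  if y = i then 1 else M x y

lemma cycPermanent_option (α : ℝ) (M : Option γ → Option γ → ℝ) :
    cycPermanent α M =
      α * M none none * cycPermanent α (fun x y => M (some x) (some y)) +
      ∑ i, M none (some i) * cycPermanent α
        (fun x y => if y = i then M (some x) none else M (some x) (some y)) := by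
  unfold cycPermanent
  rw [← Equiv.Perm.decomposeOption.symm.sum_comp, Fintype.sum_prod_type, Fintype.sum_option]
  congr 1
  · rw [Finset.mul_sum]
    refine Finset.sum_congr rfl fun π _ => ?_
    simp only [Perm.decomposeOption_symm_apply, swap_self, ← Perm.one_def, one_mul,
      Fintype.prod_option, cyc_optionCongr, optionCongr_apply, Option.map_none, Option.map_some]
    ring
  · refine Finset.sum_congr rfl fun i _ => ?_
    rw [Finset.mul_sum]
    refine Finset.sum_congr rfl fun π _ => ?_
    simp only [Perm.decomposeOption_symm_apply, cyc_swap_none_mul_optionCongr,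
      Fintype.prod_option, Perm.mul_apply, optionCongr_apply, Option.map_none, Option.map_some,
      swap_apply_left]
    have h : ∀ x, M (some x) (swap none (some i) (some (π x))) =
        if π x = i then M (some x) none else M (some x) (some (π x)) := by
      intro x
      split_ifs with h
      · rw [h, swap_apply_right]
      · rw [swap_apply_of_ne_of_ne (by simp) (by simpa using h)]
    simp only [h]
    ring

/-- The matrix `M` bordered by a row and column of ones, with corner entry `t`. -/
def bordered (t : ℝ) (M : γ → γ → ℝ) : Option γ → Option γ → ℝ
  | some x, some y => M x y
  | none, none => t
  | _, _ => 1

lemma cycPermanent_bordered (α t : ℝ) (M : γ → γ → ℝ) :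
    cycPermanent α (bordered t M) =
      α * t * cycPermanent α M + ∑ i, cycPermanent α (setColumnOne M i) := by
  simp [cycPermanent_option, bordered]
  rfl

lemma cycPermanent_bordered_join (α t : ℝ) (M : γ → γ → ℝ) :
    cycPermanent α (fun x y : Option (Option γ) => bordered t M x.join y.join) =
      (α ^ 2 + α) * t ^ 2 * cycPermanent α M +
      2 * (α + 1) * t * ∑ i, cycPermanent α (setColumnOne M i) +
      ∑ i, ∑ j ∈ univ.erase i, cycPermanent α (setColumnOne (setColumnOne M i) j) := by
  have hfirst : (fun x y : Option γ => bordered t M (some x).join (some y).join) =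
      bordered t M := by
    ext x y; simp
  have hnone : (fun x y : Option γ => if y = none then bordered t M (some x).join none.join
      else bordered t M (some x).join (some y).join) = bordered t M := by
    ext x y
    split_ifs with h
    · subst h; simp
    · simp
  have hsome (i : γ) : cycPermanent α (fun x y : Option γ => if y = some i then
      bordered t M (some x).join none.join else bordered t M (some x).join (some y).join) =
      α * t * cycPermanent α (setColumnOne M i) + t * cycPermanent α (setColumnOne M i) +
        ∑ j ∈ univ.erase i, cycPermanent α (setColumnOne (setColumnOne M i) j) := by
    rw [cycPermanent_option, ← Finset.add_sum_erase _ _ (Finset.mem_univ i), ← add_assoc]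
    congr 1
    · congr 2
      · simp [bordered]
        rfl
      · simp [bordered]
      · simp [bordered]
        congr 1
        ext x y
        simp only [setColumnOne]
        split_ifs <;> rfl
    · refine Finset.sum_congr rfl fun j hj => ?_
      have hji : j ≠ i := Finset.ne_of_mem_erase hj
      simp [bordered, hji]
      rfl
  rw [cycPermanent_option, Fintype.sum_option, hfirst, hnone]
  simp only [hsome]
  simp only [Option.join_none, Option.join_some, bordered, cycPermanent_bordered, one_mul,
    Finset.sum_add_distrib, ← Finset.mul_sum]
  ring

lemma cycPermanent_bordered_zero_join (α : ℝ) (M : γ → γ → ℝ) :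
    cycPermanent α (fun x y : Option (Option γ) => bordered 0 M x.join y.join) =
      cycPermanent α (fun x y : Option (Option γ) => bordered 1 M x.join y.join) -
      2 * (α + 1) * cycPermanent α (bordered 1 M) + α * (α + 1) * cycPermanent α M := by
  rw [cycPermanent_bordered_join, cycPermanent_bordered_join, cycPermanent_bordered]
  ring

end CyclePermanent

section LaguerreFunctional

open Polynomial

/-- The linear functional `X ^ k ↦ α (α + 1) ⋯ (α + k - 1)`. -/
noncomputable def risingFunctional (α : ℝ) : ℝ[X] →ₗ[ℝ] ℝ :=
  (Polynomial.basisMonomials ℝ).constr ℝ fun k => (ascPochhammer ℝ k).eval α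

lemma risingFunctional_X_pow (α : ℝ) (k : ℕ) :
    risingFunctional α (X ^ k) = (ascPochhammer ℝ k).eval α := by
  have h := (Polynomial.basisMonomials ℝ).constr_basis ℝ
    (fun k => (ascPochhammer ℝ k).eval α) k
  rw [Polynomial.coe_basisMonomials] at h
  rwa [Polynomial.X_pow_eq_monomial]

lemma risingFunctional_C_mul (α c : ℝ) (q : ℝ[X]) :
    risingFunctional α (C c * q) = c * risingFunctional α q := by
  rw [← smul_eq_C_mul, map_smul, smul_eq_mul]

/-- Integration by parts against the weight `x ^ (α - 1) * exp (-x)`. -/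
lemma risingFunctional_by_parts (α : ℝ) (q : ℝ[X]) :
    risingFunctional α ((C α - X) * q + X * derivative q) = 0 := by
  induction q using Polynomial.induction_on' with
  | add p q hp hq =>
    rw [derivative_add, mul_add, mul_add, add_add_add_comm, map_add, hp, hq, add_zero]
  | monomial k c =>
    have h : (C α - X) * monomial k c + X * derivative (monomial k c) =
        C (c * (α + k)) * X ^ k - C c * X ^ (k + 1) := by
      rw [← C_mul_X_pow_eq_monomial, derivative_C_mul, derivative_X_pow]
      cases k with
      | zero => simp; ring
      | succ k => simp; ring
    rw [h, map_sub, risingFunctional_C_mul, risingFunctional_C_mul, risingFunctional_X_pow,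
      risingFunctional_X_pow, ascPochhammer_succ_eval]
    ring

/-- The monic Laguerre polynomial of degree `2` with parameter `α - 1`. -/
noncomputable def laguerreTwo (α : ℝ) : ℝ[X] :=
  X ^ 2 - C (2 * (α + 1)) * X + C (α * (α + 1))

lemma risingFunctional_laguerreTwo_recurrence (α : ℝ) (n : ℕ) :
    4 * α * (2 * (n : ℝ) + 5) * ((n : ℝ) + 2) * ((n : ℝ) + 1) * (α + 1) ^ 2 *
        risingFunctional α (laguerreTwo α ^ n) +
      2 * ((n : ℝ) + 2) * (α + 1) *
        (4 * α * (n : ℝ) ^ 2 + 12 * α * (n : ℝ) - 4 * (n : ℝ) ^ 2 + 7 * α -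
          14 * (n : ℝ) - 10) * risingFunctional α (laguerreTwo α ^ (n + 1)) -
      2 * ((n : ℝ) + 2) *
        (4 * α * (n : ℝ) + 4 * (n : ℝ) ^ 2 + 8 * α + 16 * (n : ℝ) + 17) *
        risingFunctional α (laguerreTwo α ^ (n + 2)) +
      (2 * (n : ℝ) + 3) * risingFunctional α (laguerreTwo α ^ (n + 3)) = 0 := by
  have h := risingFunctional_by_parts α (laguerreTwo α ^ (n + 1) *
    (C (2 * α ^ 3 * n + 3 * α ^ 3 - 8 * α ^ 2 * n ^ 2 - 28 * α ^ 2 * n - 26 * α ^ 2 -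
        16 * α * n ^ 2 - 66 * α * n - 69 * α - 8 * n ^ 2 - 36 * n - 40) +
      C (12 * α * n ^ 2 + 36 * α * n + 29 * α + 12 * n ^ 2 + 42 * n + 38 - 6 * α ^ 2 * n -
        9 * α ^ 2) * X +
      C (6 * α * n + 9 * α - 4 * n ^ 2 - 8 * n - 3) * X ^ 2 -
      C (2 * (n : ℝ) + 3) * X ^ 3))
  rw [← h]
  simp only [← risingFunctional_C_mul, ← map_add, ← map_sub]
  congr 1
  have hp : derivative (laguerreTwo α) = 2 * X - C (2 * (α + 1)) := by
    simp [laguerreTwo]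
    norm_num
  rw [derivative_mul, derivative_pow_succ, hp]
  simp only [derivative_add, derivative_sub, derivative_C_mul, derivative_C, derivative_X_pow,
    derivative_X, pow_add _ n]
  generalize laguerreTwo α ^ n = P
  simp only [laguerreTwo, map_add, map_sub, map_mul, map_pow, map_natCast, map_ofNat, map_one,
    Nat.cast_ofNat, Nat.reduceSub]
  ring

end LaguerreFunctional

section BlockDerangements

variable {β γ ι : Type} [Fintype β] [DecidableEq β] [Fintype γ] [DecidableEq γ] [DecidableEq ι]

/-- The matrix forbidding moves inside a block whose colour lies in `s`. -/
def blockMatrix (c : β → ι) (s : Finset ι) (x y : β) : ℝ :=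
  if c x = c y ∧ c x ∈ s then 0 else 1

lemma cycPermanent_one (α : ℝ) :
    cycPermanent α (fun _ _ : β => 1) = (ascPochhammer ℝ (Fintype.card β)).eval α := by
  induction h : Fintype.card β generalizing β with
  | zero =>
    have : IsEmpty β := Fintype.card_eq_zero_iff.1 h
    simp [cycPermanent, cyc]
  | succ k ih =>
    have e : Option (Fin k) ≃ β := Fintype.equivOfCardEq (by simp [h])
    rw [← cycPermanent_reindex α e, cycPermanent_option]
    simp only [ite_self, ih (Fintype.card_fin k), ascPochhammer_succ_eval, sum_const, card_univ,
      Fintype.card_fin, nsmul_eq_mul]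
    ring

lemma cycPermanent_blockMatrix_insert (α : ℝ) (c : Option (Option γ) → ι) {s : Finset ι} {i : ι}
    (hi : i ∉ s) (h₁ : c none = i) (h₂ : c (some none) = i) (h₃ : ∀ x, c (some (some x)) ≠ i) :
    cycPermanent α (blockMatrix c (insert i s)) =
      cycPermanent α (blockMatrix c s) -
      2 * (α + 1) * cycPermanent α (blockMatrix (fun x => c (some x)) s) +
      α * (α + 1) * cycPermanent α (blockMatrix (fun x => c (some (some x))) s) := by
  have e₁ : blockMatrix c (insert i s) = fun x y =>
      bordered 0 (blockMatrix (fun x => c (some (some x))) s) x.join y.join := by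
    ext x y
    rcases x with _ | _ | x <;> rcases y with _ | _ | y <;>
      simp [blockMatrix, bordered, h₁, h₂, h₃, fun x => (h₃ x).symm]
  have e₂ : blockMatrix c s = fun x y =>
      bordered 1 (blockMatrix (fun x => c (some (some x))) s) x.join y.join := by
    ext x y
    rcases x with _ | _ | x <;> rcases y with _ | _ | y <;>
      simp [blockMatrix, bordered, h₁, h₂, h₃, hi]
  have e₃ : blockMatrix (fun x => c (some x)) s =
      bordered 1 (blockMatrix (fun x => c (some (some x))) s) := by
    ext x y
    rcases x with _ | x <;> rcases y with _ | y <;>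
      simp [blockMatrix, bordered, h₂, h₃, hi]
  rw [e₁, e₂, e₃, cycPermanent_bordered_zero_join]

lemma exists_equiv_option_option {a b : β} (hab : a ≠ b) :
    ∃ (γ : Type) (_ : Fintype γ) (_ : DecidableEq γ) (e : Option (Option γ) ≃ β),
      e none = a ∧ e (some none) = b := by
  let b' : {x // x ≠ a} := ⟨b, hab.symm⟩
  exact ⟨{y : {x // x ≠ a} // y ≠ b'}, inferInstance, inferInstance,
    (Equiv.optionCongr (Equiv.optionSubtypeNe b')).trans (Equiv.optionSubtypeNe a), rfl, rfl⟩

open Polynomial in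
lemma cycPermanent_blockMatrix (α : ℝ) (s : Finset ι) (c : β → ι)
    (hc : ∀ i ∈ s, #{x | c x = i} = 2) :
    cycPermanent α (blockMatrix c s) =
      risingFunctional α (X ^ #{x | c x ∉ s} * laguerreTwo α ^ #s) := by
  induction s using Finset.induction_on generalizing β with
  | empty =>
    have h : blockMatrix c ∅ = fun _ _ => 1 := by
      ext x y
      simp [blockMatrix]
    simp [h, cycPermanent_one, risingFunctional_X_pow]
  | insert i s hi ih =>
    obtain ⟨a, b, hab, hi2⟩ := Finset.card_eq_two.1 (hc i (mem_insert_self i s))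
    obtain ⟨γ, _, _, e, rfl, rfl⟩ := exists_equiv_option_option hab
    have hmem (x : β) : c x = i ↔ x = e none ∨ x = e (some none) := by
      simpa using Finset.ext_iff.1 hi2 x
    have h₁ : c (e none) = i := (hmem _).2 (.inl rfl)
    have h₂ : c (e (some none)) = i := (hmem _).2 (.inr rfl)
    have h₃ (x : γ) : c (e (some (some x))) ≠ i := by simp [hmem]
    have hcount (P : β → Prop) [DecidablePred P] : #{x | P x} =
        (if P (e none) then 1 else 0) + ((if P (e (some none)) then 1 else 0) +
          #{x | P (e (some (some x)))}) := by
      rw [Finset.card_filter, ← e.sum_comp, Fintype.sum_option, Fintype.sum_option,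
        Finset.card_filter]
    have hc' : ∀ j ∈ s, #{x : γ | c (e (some (some x))) = j} = 2 := by
      intro j hj
      have hij : i ≠ j := fun h => hi (h ▸ hj)
      have := hc j (mem_insert_of_mem hj)
      rw [hcount] at this
      simpa [h₁, h₂, hij] using this
    have hc'' : ∀ j ∈ s, #{x : Option γ | c (e (some x)) = j} = 2 := by
      intro j hj
      have hij : i ≠ j := fun h => hi (h ▸ hj)
      rw [Finset.card_filter, Fintype.sum_option, ← Finset.card_filter, hc' j hj]
      simp [h₂, hij]
    have hc''' : ∀ j ∈ s, #{x : Option (Option γ) | c (e x) = j} = 2 := by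
      intro j hj
      have hij : i ≠ j := fun h => hi (h ▸ hj)
      rw [Finset.card_filter, Fintype.sum_option, ← Finset.card_filter, hc'' j hj]
      simp [h₁, hij]
    have k₀ : #{x | c x ∉ insert i s} = #{x : γ | c (e (some (some x))) ∉ s} := by
      rw [hcount]
      simp [h₁, h₂, h₃]
    have k₁ : #{x : Option γ | c (e (some x)) ∉ s} =
        #{x : γ | c (e (some (some x))) ∉ s} + 1 := by
      rw [Finset.card_filter, Fintype.sum_option, ← Finset.card_filter]
      simp [h₂, hi, add_comm]
    have k₂ : #{x : Option (Option γ) | c (e x) ∉ s} =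
        #{x : γ | c (e (some (some x))) ∉ s} + 2 := by
      rw [Finset.card_filter, Fintype.sum_option, ← Finset.card_filter, k₁]
      simp [h₁, hi]
      ring
    rw [← cycPermanent_reindex α e]
    change cycPermanent α (blockMatrix (fun x => c (e x)) (insert i s)) = _
    rw [cycPermanent_blockMatrix_insert α _ hi h₁ h₂ h₃, ih _ hc', ih _ hc'', ih _ hc''',
      k₀, k₁, k₂, ← risingFunctional_C_mul, ← risingFunctional_C_mul, ← map_sub, ← map_add,
      Finset.card_insert_of_notMem hi, pow_succ (laguerreTwo α)]
    congr 1
    simp only [laguerreTwo]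
    ring

lemma F2_eq_risingFunctional {m : ℕ} (f : Fin (2 * m) → Fin m)
    (hf : ∀ i : Fin m, #{x | f x = i} = 2) (α : ℝ) :
    F2 f α = risingFunctional α (laguerreTwo α ^ m) := by
  have h := cycPermanent_blockMatrix α univ f fun i _ => hf i
  simp only [mem_univ, not_true_eq_false, filter_false, card_empty, pow_zero, one_mul,
    card_univ, Fintype.card_fin] at h
  rw [← h, F2, cycPermanent, Finset.sum_filter]
  refine Finset.sum_congr rfl fun π _ => ?_
  split_ifs with hπ
  · rw [Finset.prod_eq_one, mul_one]
    intro x _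
    simp [blockMatrix, (hπ x).symm]
  · push Not at hπ
    obtain ⟨x, hx⟩ := hπ
    rw [Finset.prod_eq_zero (mem_univ x) (by simp [blockMatrix, hx]), mul_zero]

end BlockDerangements

/-- **Recurrence for weighted multiset derangements with blocks of size 2.**
For every `n ≥ 0`,
`4α(2n+5)(n+2)(n+1)(α+1)² F_2(n) + 2(n+2)(α+1)(4αn²+12αn-4n²+7α-14n-10) F_2(n+1)
 - 2(n+2)(4αn+4n²+8α+16n+17) F_2(n+2) + (2n+3) F_2(n+3) = 0`. -/
theorem F2_recurrence (n : ℕ) (α : ℝ)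
    (f : ∀ m : ℕ, Fin (2 * m) → Fin m)
    (hf : ∀ m : ℕ, ∀ i : Fin m, (Finset.univ.filter fun x => f m x = i).card = 2) :
    4 * α * (2 * (n : ℝ) + 5) * ((n : ℝ) + 2) * ((n : ℝ) + 1) * (α + 1) ^ 2 *
        F2 (f n) α +
      2 * ((n : ℝ) + 2) * (α + 1) *
        (4 * α * (n : ℝ) ^ 2 + 12 * α * (n : ℝ) - 4 * (n : ℝ) ^ 2 + 7 * α -
          14 * (n : ℝ) - 10) * F2 (f (n + 1)) α -
      2 * ((n : ℝ) + 2) *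
        (4 * α * (n : ℝ) + 4 * (n : ℝ) ^ 2 + 8 * α + 16 * (n : ℝ) + 17) *
        F2 (f (n + 2)) α +
      (2 * (n : ℝ) + 3) * F2 (f (n + 3)) α = 0 := by
  simpa only [F2_eq_risingFunctional _ (hf _)] using risingFunctional_laguerreTwo_recurrence α n
end

section
/- The product k_1! k_2! ⋯ k_n! divides the cardinality |D(k_1,…,k_n)| of the set of multiset derangements (so that identifying the elements within each block, the number of multiset derangements with identified elements equals |D(k_1,…,k_n)| / ∏_{i=1}^n k_i!). -/
open Finset

/-- The permutations carrying a colouring `f` to `f ∘ σ` form a coset of the stabilizer of `f`. -/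
theorem card_perm_comp_eq_comp {α ι : Type*} [Fintype α] [DecidableEq α] [Fintype ι]
    [DecidableEq ι] (f : α → ι) (σ : Equiv.Perm α) :
    #{π : Equiv.Perm α | f ∘ π = f ∘ σ} = ∏ i, (#{x | f x = i}).factorial := by
  have h := DomMulAct.stabilizer_card f
  simp only [Fintype.card_subtype] at h
  rw [← h]
  refine card_equiv (Equiv.mulRight σ⁻¹) fun π => ?_
  simp only [mem_filter, mem_univ, true_and, Equiv.coe_mulRight, Equiv.Perm.coe_mul,
    ← Function.comp_assoc]
  exact (Equiv.comp_symm_eq σ f (f ∘ π)).symm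

/-- The product `k_1! k_2! ⋯ k_n!` divides the number of multiset derangements
`|D(k_1,…,k_n)|` (so identifying the elements within each block, the number of
multiset derangements with identified elements is `|D(k_1,…,k_n)| / ∏ k_i!`). -/
theorem factorial_product_dvd_multiset_derangements (n : ℕ) (hn : 1 ≤ n)
    (k : Fin n → ℕ) (hk : ∀ i, 1 ≤ k i)
    (f : Fin (∑ i, k i) → Fin n)
    (hf : ∀ i : Fin n, (Finset.univ.filter fun x => f x = i).card = k i) :
    (∏ i, Nat.factorial (k i)) ∣
      (Finset.univ.filter
        fun π : Equiv.Perm (Fin (∑ i, k i)) => ∀ x, f (π x) ≠ f x).card := by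
  rw [card_eq_sum_card_image (fun π : Equiv.Perm (Fin (∑ i, k i)) => f ∘ π)]
  refine dvd_sum fun g hg => ?_
  obtain ⟨σ, hσ, rfl⟩ := mem_image.mp hg
  have hσ' : ∀ x, f (σ x) ≠ f x := (mem_filter.mp hσ).2
  have key := card_perm_comp_eq_comp f σ
  simp only [hf] at key
  rw [← key, filter_filter]
  refine dvd_of_eq (congrArg card (filter_congr fun π _ => ?_))
  refine ⟨fun h => ⟨fun x => ?_, h⟩, And.right⟩
  rw [show f (π x) = f (σ x) from congrFun h x]
  exact hσ' x
end

section
/- Deck-of-cards derangement count: The number of multiset derangements of 13 blocks of size 4 (with all 52 elements distinct) satisfies |D(4,4,…,4)| = 1493804444499093354916284290188948031229880469556 · (4!)^{13}; equivalently, the number of ways to derange a standard deck of 52 cards so that no card lands in a position originally occupied by a card of the same rank, with elements of the same rank identified, is 1493804444499093354916284290188948031229880469556. -/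
open Finset
open Polynomial

/-- The permutations `π` such that every `x ∈ S` is sent to an element of its own block. -/
def blockFixing {α β : Type*} [Fintype α] [DecidableEq α] [DecidableEq β] (f : α → β)
    (S : Finset α) : Finset (Equiv.Perm α) :=
  {π | ∀ x ∈ S, f (π x) = f x}

section
variable {α β : Type*} [Fintype α] [DecidableEq α] [DecidableEq β] (f : α → β)

lemma mem_blockFixing {S : Finset α} {π : Equiv.Perm α} :
    π ∈ blockFixing f S ↔ ∀ x ∈ S, f (π x) = f x := by
  simp [blockFixing]

lemma card_filter_notMem_of_mem_blockFixing {S : Finset α} {π : Equiv.Perm α}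
    (hπ : π ∈ blockFixing f S) (i : β) :
    #{b ∈ Sᶜ | f (π b) = i} = #{x | f x = i} - #{x ∈ S | f x = i} := by
  rw [mem_blockFixing] at hπ
  have h₁ : #{b | f (π b) = i} = #{x | f x = i} :=
    card_bij (fun b _ ↦ π b) (by simp) (by simp) fun x hx ↦ ⟨π.symm x, by simpa using hx, by simp⟩
  have h₂ : ({x ∈ S | f x = i} : Finset α) = {b ∈ S | f (π b) = i} :=
    filter_congr fun x hx ↦ by rw [hπ x hx]
  have h₃ : #{b ∈ S | f (π b) = i} + #{b ∈ Sᶜ | f (π b) = i} = #{b | f (π b) = i} := by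
    rw [← card_union_of_disjoint (disjoint_filter_filter disjoint_compl_right), ← filter_union,
      union_compl]
  rw [h₂, ← h₁, ← h₃, Nat.add_sub_cancel_left]

lemma card_blockFixing_insert {S : Finset α} {a : α} (ha : a ∉ S) :
    #(blockFixing f (insert a S)) * #Sᶜ =
      #(blockFixing f S) * (#{x | f x = f a} - #{x ∈ S | f x = f a}) := by
  have h : #(blockFixing f (insert a S) ×ˢ Sᶜ) =
      #((blockFixing f S).sigma fun π ↦ {b ∈ Sᶜ | f (π b) = f a}) := by
    have key : ∀ {b : α}, b ∉ S → ∀ x ∈ S, Equiv.swap a b x = x := fun hb x hx ↦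
      Equiv.swap_apply_of_ne_of_ne (by rintro rfl; exact ha hx) (by rintro rfl; exact hb hx)
    refine card_bij' (fun p _ ↦ ⟨p.1 * Equiv.swap a p.2, p.2⟩)
      (fun p _ ↦ (p.1 * Equiv.swap a p.2, p.2)) ?_ ?_ ?_ ?_
    · rintro ⟨π, b⟩ h
      simp only [mem_product, mem_blockFixing, mem_insert, forall_eq_or_imp, mem_compl] at h
      refine mem_sigma.2 ⟨(mem_blockFixing f).2 fun x hx ↦ ?_, mem_filter.2 ⟨mem_compl.2 h.2, ?_⟩⟩
      · rw [Equiv.Perm.mul_apply, key h.2 x hx, h.1.2 x hx]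
      · rw [Equiv.Perm.mul_apply, Equiv.swap_apply_right, h.1.1]
    · rintro ⟨π, b⟩ h
      simp only [mem_sigma, mem_blockFixing, mem_filter, mem_compl] at h
      simp only [mem_product, mem_blockFixing, mem_insert, forall_eq_or_imp, mem_compl,
        Equiv.Perm.mul_apply, Equiv.swap_apply_left]
      exact ⟨⟨h.2.2, fun x hx ↦ by rw [key h.2.1 x hx, h.1 x hx]⟩, h.2.1⟩
    · simp [mul_assoc]
    · simp [mul_assoc]
  rw [card_product, card_sigma] at h
  rw [h, sum_congr rfl fun π hπ ↦ card_filter_notMem_of_mem_blockFixing f hπ (f a), sum_const,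
    smul_eq_mul]

lemma card_blockFixing [Fintype β] (S : Finset α) :
    #(blockFixing f S) = (Fintype.card α - #S).factorial *
      ∏ i, (#{x | f x = i}).descFactorial #{x ∈ S | f x = i} := by
  induction S using Finset.induction_on with
  | empty => simp [blockFixing, Fintype.card_perm]
  | insert a S ha ih =>
    have hS : #S < Fintype.card α := by
      rw [← card_univ]
      exact card_lt_card (ssubset_univ_iff.2 fun h ↦ ha (by rw [h]; exact mem_univ a))
    have hpos : 0 < #Sᶜ := by rw [card_compl]; omega
    have hcard : (#{x ∈ insert a S | f x = f a}) = #{x ∈ S | f x = f a} + 1 := by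
      rw [filter_insert, if_pos rfl, card_insert_of_notMem (by simp [ha])]
    have hother : ∀ i ∈ univ.erase (f a),
        (#{x | f x = i}).descFactorial #{x ∈ insert a S | f x = i} =
          (#{x | f x = i}).descFactorial #{x ∈ S | f x = i} := fun i hi ↦ by
      rw [filter_insert, if_neg (ne_of_mem_erase hi).symm]
    apply Nat.eq_of_mul_eq_mul_right hpos
    rw [card_blockFixing_insert f ha, ih, ← mul_prod_erase univ _ (mem_univ (f a)),
      ← mul_prod_erase univ _ (mem_univ (f a)), prod_congr rfl hother, hcard,
      Nat.descFactorial_succ, card_insert_of_notMem ha, card_compl]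
    obtain ⟨m, hm⟩ : ∃ m, Fintype.card α - #S = m + 1 := ⟨Fintype.card α - #S - 1, by omega⟩
    rw [Nat.sub_add_eq, hm, Nat.factorial_succ, Nat.add_sub_cancel]
    ring

lemma card_blockDerangements :
    (#{π : Equiv.Perm α | ∀ x, f (π x) ≠ f x} : ℤ) =
      ∑ S : Finset α, (-1) ^ #S * (#(blockFixing f S) : ℤ) := by
  have h (π : Equiv.Perm α) : (if ∀ x, f (π x) ≠ f x then 1 else 0 : ℤ) =
      ∑ S : Finset α, (-1) ^ #S * if π ∈ blockFixing f S then 1 else 0 := by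
    have := prod_one_add (f := fun x ↦ (-1 : ℤ) * if f (π x) = f x then 1 else 0) univ
    rw [powerset_univ] at this
    simp only [prod_mul_distrib, prod_const, prod_boole] at this
    trans ∏ x, (1 + (-1 : ℤ) * if f (π x) = f x then 1 else 0)
    · rw [← Fintype.prod_boole]
      exact prod_congr rfl fun x _ ↦ by by_cases hx : f (π x) = f x <;> simp [hx]
    · rw [this]
      exact sum_congr rfl fun S _ ↦ by simp [mem_blockFixing]
  rw [card_filter, Nat.cast_sum]
  simp only [Nat.cast_ite, Nat.cast_one, Nat.cast_zero, h]
  rw [sum_comm]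
  refine sum_congr rfl fun S _ ↦ ?_
  rw [← mul_sum, sum_boole]
  simp

lemma sum_prod_filter_eq_prod_sum_powerset [Fintype β] {R : Type*} [CommSemiring R]
    (w : β → Finset α → R) :
    ∑ S : Finset α, ∏ i, w i {x ∈ S | f x = i} =
      ∏ i, ∑ T ∈ ({x | f x = i} : Finset α).powerset, w i T := by
  rw [prod_univ_sum]
  refine sum_bij' (fun S _ i ↦ {x ∈ S | f x = i}) (fun p _ ↦ univ.biUnion p) ?_ ?_ ?_ ?_ ?_
  · intro S _
    simp only [Fintype.mem_piFinset, mem_powerset]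
    exact fun i ↦ filter_subset_filter _ (subset_univ S)
  · simp
  · intro S _
    ext x
    simp
  · intro p hp
    simp only [Fintype.mem_piFinset, mem_powerset] at hp
    ext i x
    simp only [mem_filter, mem_biUnion, mem_univ, true_and]
    constructor
    · rintro ⟨⟨j, hj⟩, rfl⟩
      have := hp j hj
      simp only [mem_filter, mem_univ, true_and] at this
      rwa [this]
    · intro hx
      exact ⟨⟨i, hx⟩, by simpa using hp i hx⟩
  · simp

end

/-- The linear functional on polynomials sending `X ^ k` to `(n - k)!`. -/
noncomputable def factorialFunctional (n : ℕ) : ℤ[X] →ₗ[ℤ] ℤ :=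
  lsum fun k ↦ ((n - k).factorial : ℤ) • LinearMap.id

lemma factorialFunctional_C_mul_X_pow (n k : ℕ) (c : ℤ) :
    factorialFunctional n (C c * X ^ k) = c * (n - k).factorial := by
  rw [C_mul_X_pow_eq_monomial, factorialFunctional, lsum_apply, sum_monomial_index] <;>
    simp [mul_comm]

/-- The signed rook polynomial of a full `c × c` board. -/
noncomputable def signedRookPolynomial (c : ℕ) : ℤ[X] :=
  ∑ k ∈ range (c + 1), C ((-1) ^ k * (c.choose k * c.descFactorial k : ℤ)) * X ^ k

theorem card_blockDerangements_eq_factorialFunctional {α β : Type*} [Fintype α] [DecidableEq α]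
    [Fintype β] [DecidableEq β] (f : α → β) :
    (#{π : Equiv.Perm α | ∀ x, f (π x) ≠ f x} : ℤ) =
      factorialFunctional (Fintype.card α) (∏ i, signedRookPolynomial #{x | f x = i}) := by
  have h (i : β) : signedRookPolynomial #{x | f x = i} =
      ∑ T ∈ ({x | f x = i} : Finset α).powerset,
        C ((-1) ^ #T * ((#{x | f x = i}).descFactorial #T : ℤ)) * X ^ #T := by
    rw [sum_powerset_apply_card fun k ↦
      C ((-1) ^ k * ((#{x | f x = i}).descFactorial k : ℤ)) * X ^ k]
    refine sum_congr rfl fun k _ ↦ ?_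
    simp only [nsmul_eq_mul, map_mul, map_natCast]
    ring
  rw [card_blockDerangements, prod_congr rfl fun i _ ↦ h i,
    ← sum_prod_filter_eq_prod_sum_powerset f, map_sum]
  refine sum_congr rfl fun S _ ↦ ?_
  have hS : ∑ i, #{x ∈ S | f x = i} = #S := (card_eq_sum_card_fiberwise (by simp)).symm
  rw [prod_mul_distrib, prod_pow_eq_pow_sum, ← map_prod, hS, factorialFunctional_C_mul_X_pow,
    prod_mul_distrib, prod_pow_eq_pow_sum, hS, card_blockFixing]
  push_cast
  ring

/-- `IsMomentList φ q l` says that the entries of `l` are `φ q, φ (X * q), φ (X ^ 2 * q), …`. -/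
def IsMomentList (φ : ℤ[X] →ₗ[ℤ] ℤ) : ℤ[X] → List ℤ → Prop
  | _, [] => True
  | q, a :: l => a = φ q ∧ IsMomentList φ (X * q) l

/-- The effect on moments of multiplying by the signed rook polynomial of a `4 × 4` board. -/
def rookStep : List ℤ → List ℤ
  | a :: b :: c :: d :: e :: l =>
    (a - 16 * b + 72 * c - 96 * d + 24 * e) :: rookStep (b :: c :: d :: e :: l)
  | _ => []

lemma signedRookPolynomial_four :
    signedRookPolynomial 4 = 1 - 16 * X + 72 * X ^ 2 - 96 * X ^ 3 + 24 * X ^ 4 := by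
  simp [signedRookPolynomial, sum_range_succ, Nat.choose, Nat.descFactorial]
  ring

lemma IsMomentList.rookStep {φ : ℤ[X] →ₗ[ℤ] ℤ} {l : List ℤ} :
    ∀ {q : ℤ[X]}, IsMomentList φ q l →
      IsMomentList φ (signedRookPolynomial 4 * q) (rookStep l) := by
  induction l using rookStep.induct with
  | case1 a b c d e l ih =>
    intro q h
    rw [_root_.rookStep]
    refine ⟨?_, ?_⟩
    · obtain ⟨rfl, rfl, rfl, rfl, rfl, -⟩ := h
      have : signedRookPolynomial 4 * q = q - (16 : ℤ) • (X * q) + (72 : ℤ) • (X * (X * q))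
          - (96 : ℤ) • (X * (X * (X * q))) + (24 : ℤ) • (X * (X * (X * (X * q)))) := by
        rw [signedRookPolynomial_four]
        simp only [zsmul_eq_mul]
        push_cast
        ring
      simp only [this, map_add, map_sub, map_smul, smul_eq_mul]
    · rw [mul_left_comm]
      exact ih h.2
  | case2 l hl =>
    intro q _
    rw [_root_.rookStep.eq_2 _ hl]
    trivial

lemma IsMomentList.iterate_rookStep {φ : ℤ[X] →ₗ[ℤ] ℤ} {q : ℤ[X]} {l : List ℤ}
    (h : IsMomentList φ q l) (m : ℕ) :
    IsMomentList φ (signedRookPolynomial 4 ^ m * q) (_root_.rookStep^[m] l) := by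
  induction m with
  | zero => simpa using h
  | succ m ih =>
    rw [Function.iterate_succ_apply', pow_succ', mul_assoc]
    exact ih.rookStep

lemma isMomentList_factorialFunctional (n m : ℕ) : ∀ k,
    IsMomentList (factorialFunctional n) (X ^ k)
      ((List.range' k m).map fun j ↦ ((n - j).factorial : ℤ)) := by
  induction m with
  | zero => exact fun _ ↦ trivial
  | succ m ih =>
    intro k
    refine ⟨?_, ?_⟩
    · simpa using (factorialFunctional_C_mul_X_pow n k 1).symm
    · rw [← pow_succ']
      exact ih (k + 1)

/-- **Deck-of-cards derangement count.**  With blocks the 13 ranks, each of size 4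
(given as the fibers of `f : Fin 52 → Fin 13`), the number of multiset derangements
of a standard deck of 52 distinct cards is
`1493804444499093354916284290188948031229880469556 · (4!)^13`. -/
theorem deck_derangements (f : Fin 52 → Fin 13)
    (hf : ∀ i : Fin 13, (Finset.univ.filter fun x => f x = i).card = 4) :
    (Finset.univ.filter
        fun π : Equiv.Perm (Fin 52) => ∀ x, f (π x) ≠ f x).card =
      1493804444499093354916284290188948031229880469556 *
        (Nat.factorial 4) ^ 13 := by
  have hlist : rookStep^[13] ((List.range' 0 53).map fun j ↦ ((52 - j).factorial : ℤ)) =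
      [1493804444499093354916284290188948031229880469556 * 24 ^ 13] := by
    decide +kernel
  have hmoment := (isMomentList_factorialFunctional 52 53 0).iterate_rookStep 13
  rw [hlist, pow_zero, mul_one] at hmoment
  have hcard := card_blockDerangements_eq_factorialFunctional f
  simp only [hf, prod_const, card_univ, Fintype.card_fin] at hcard
  rw [← hmoment.1] at hcard
  exact_mod_cast hcard
end
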